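/- arXiv:1908.06529 — 2 statements merged into one kernel-verified Lean document; each statement's English description precedes it below -/
import Mathlib

section
/- Every centralizer defined on a normed sequence space is quasilinear. Precisely: let N : c00 → [0,∞) be a norm on c00 which is solid, i.e., if |y(n)| ≤ |x(n)| for all n then N(y) ≤ N(x). Let Y be a real Banach space equipped with a module multiplication (a, y) ↦ a·y by bounded sequences a : ℕ → ℝ which is bilinear, satisfies ‖a·y‖ ≤ ‖a‖_∞‖y‖ and 1_ℕ·y = y. Let Φ : c00 → Y be a homogeneous map for which there is a constant C such that ‖Φ(a·x) − a·Φ(x)‖ ≤ C‖a‖_∞·N(x) for every bounded sequence a and every x ∈ c00. Then there is a constant Q such that ‖Φ(x+y) − Φ(x) − Φ(y)‖ ≤ Q(N(x) + N(y)) for all x, y ∈ c00. -/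
open scoped ENNReal

/-- `x : ℕ → ℝ` is finitely supported (i.e. belongs to `c00`). -/
def FinSupp (x : ℕ → ℝ) : Prop := (Function.support x).Finite

/-- The Banach algebra `ℓ_∞` of bounded real sequences. -/
noncomputable abbrev Linf : Type := lp (fun _ : ℕ => ℝ) ∞

/-- If `|x| ≤ z` pointwise, then `x = a · z` for some `a` in the unit ball of `ℓ_∞`. -/
theorem exists_linf_mul_eq {x z : ℕ → ℝ} (h : ∀ n, |x n| ≤ z n) :
    ∃ a : Linf, ‖a‖ ≤ 1 ∧ ∀ n, a n * z n = x n := by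
  have hb : ∀ n, ‖x n / z n‖ ≤ 1 := fun n => by
    rw [Real.norm_eq_abs, abs_div, abs_of_nonneg ((abs_nonneg _).trans (h n))]
    exact div_le_one_of_le₀ (h n) ((abs_nonneg _).trans (h n))
  refine ⟨⟨fun n => x n / z n, memℓp_infty ⟨1, Set.forall_mem_range.2 hb⟩⟩,
    lp.norm_le_of_forall_le zero_le_one hb, fun n => div_mul_cancel_of_imp fun hz => ?_⟩
  exact abs_nonpos_iff.1 ((h n).trans_eq hz)

theorem FinSupp.abs {x : ℕ → ℝ} (hx : FinSupp x) : FinSupp (fun n => |x n|) :=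
  hx.subset fun n hn => by simpa using hn

theorem FinSupp.add {x y : ℕ → ℝ} (hx : FinSupp x) (hy : FinSupp y) : FinSupp (x + y) :=
  (hx.union hy).subset (Function.support_add x y)

/-- Every centralizer defined on a normed sequence space is quasilinear.
Here `N` is a solid norm on `c00`, `Y` is a real Banach space which is a module over
`ℓ_∞` (the module structure being bilinear, with `‖a • y‖ ≤ ‖a‖_∞‖y‖` and `1 • y = y`,
which is expressed by the instances `[Module Linf Y]`, `[IsScalarTower ℝ Linf Y]` and the
hypothesis `hmod`), and `Φ : c00 → Y` is a homogeneous map satisfying the centralizer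
estimate `‖Φ(a·x) − a·Φ(x)‖ ≤ C‖a‖_∞·N(x)`. Then `Φ` is quasilinear:
`‖Φ(x+y) − Φ(x) − Φ(y)‖ ≤ Q(N(x) + N(y))` for some constant `Q`. -/
theorem centralizer_is_quasilinear
    (N : (ℕ → ℝ) → ℝ)
    (hN_nonneg : ∀ x : ℕ → ℝ, FinSupp x → 0 ≤ N x)
    (hN_zero : ∀ x : ℕ → ℝ, FinSupp x → (N x = 0 ↔ x = 0))
    (hN_homog : ∀ (c : ℝ) (x : ℕ → ℝ), FinSupp x → N (c • x) = |c| * N x)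
    (hN_triangle : ∀ x y : ℕ → ℝ, FinSupp x → FinSupp y → N (x + y) ≤ N x + N y)
    (hN_solid : ∀ x y : ℕ → ℝ, FinSupp x → FinSupp y →
      (∀ n, |y n| ≤ |x n|) → N y ≤ N x)
    (Y : Type*) [NormedAddCommGroup Y] [NormedSpace ℝ Y] [CompleteSpace Y]
    [Module Linf Y] [IsScalarTower ℝ Linf Y]
    (hmod : ∀ (a : Linf) (y : Y), ‖a • y‖ ≤ ‖a‖ * ‖y‖)
    (Φ : (ℕ → ℝ) → Y)
    (hΦ_homog : ∀ (c : ℝ) (x : ℕ → ℝ), FinSupp x → Φ (c • x) = c • Φ x)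
    (C : ℝ)
    (hΦ_cent : ∀ (a : Linf) (x : ℕ → ℝ), FinSupp x →
      ‖Φ (fun n => a n * x n) - a • Φ x‖ ≤ C * ‖a‖ * N x) :
    ∃ Q : ℝ, ∀ x y : ℕ → ℝ, FinSupp x → FinSupp y →
      ‖Φ (x + y) - Φ x - Φ y‖ ≤ Q * (N x + N y) := by
  refine ⟨4 * |C|, fun x y hx hy => ?_⟩
  set z : ℕ → ℝ := (fun n => |x n|) + fun n => |y n| with hz
  have hzs : FinSupp z := hx.abs.add hy.abs
  have hNz : N z ≤ N x + N y :=
    (hN_triangle _ _ hx.abs hy.abs).trans <| add_le_add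
      (hN_solid _ _ hx hx.abs fun n => (abs_abs _).le)
      (hN_solid _ _ hy hy.abs fun n => (abs_abs _).le)
  obtain ⟨a, ha, hax⟩ := exists_linf_mul_eq (x := x) (z := z)
    fun n => le_add_of_nonneg_right (abs_nonneg _)
  obtain ⟨b, hb, hby⟩ := exists_linf_mul_eq (x := y) (z := z)
    fun n => le_add_of_nonneg_left (abs_nonneg _)
  have key : ∀ (c : Linf) (w : ℕ → ℝ) (r : ℝ), ‖c‖ ≤ r → (∀ n, c n * z n = w n) →
      ‖Φ w - c • Φ z‖ ≤ |C| * r * N z := fun c w r hc hw => by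
    have h := hΦ_cent c z hzs
    rw [funext hw] at h
    have := hN_nonneg z hzs
    refine h.trans ?_
    gcongr
    exact le_abs_self C
  have h₁ := key a x 1 ha hax
  have h₂ := key b y 1 hb hby
  have h₃ := key (a + b) (x + y) 2 ((norm_add_le a b).trans (by linarith)) fun n => by
    rw [lp.coeFn_add, Pi.add_apply, add_mul, hax, hby, Pi.add_apply]
  calc ‖Φ (x + y) - Φ x - Φ y‖
      = ‖(Φ (x + y) - (a + b) • Φ z) - (Φ x - a • Φ z) - (Φ y - b • Φ z)‖ := by
        rw [add_smul]; congr 1; abel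
    _ ≤ ‖Φ (x + y) - (a + b) • Φ z‖ + ‖Φ x - a • Φ z‖ + ‖Φ y - b • Φ z‖ :=
        (norm_sub_le _ _).trans (add_le_add_left (norm_sub_le _ _) _)
    _ ≤ 4 * |C| * N z := by linarith
    _ ≤ 4 * |C| * (N x + N y) := by gcongr
end

section
/- Let k ≥ 1, let S ⊆ ℕ be a finite set with |S| = 2^k, and let I, J : 𝒯_k → P(S) be adequate partitions of S with associated vectors x_α = Σ_{i∈I(α)} e_i and y_α = Σ_{i∈J(α)} e_i. Let Φ, H : c00 → ℓ₂ be homogeneous support-preserving maps and K a constant such that whenever x, y ∈ c00 have disjoint supports and ‖x‖₂ = ‖y‖₂ one has ‖H(x+y) − H(x) − H(y) − Φ(x+y)‖₂ ≤ K‖x‖₂. Then ‖Σ_{α∈𝒯_k}(Φ(x_α) − Φ(y_α))‖₂ ≤ 2Kk√(2^{k−1}). -/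
/-- The `ℓ₂` norm of a sequence, `‖x‖₂ = (∑ₙ |x n|²)^{1/2}`. -/
noncomputable def l2Norm (x : ℕ → ℝ) : ℝ := Real.sqrt (∑' n, (x n) ^ 2)

/-- The indicator vector `1_A = Σ_{i∈A} e_i` of a finite set `A ⊆ ℕ`. -/
noncomputable def indVec (A : Finset ℕ) : ℕ → ℝ := fun n => if n ∈ A then 1 else 0

/-- An adequate partition of a finite set `S` of cardinality `2^k`: a map `I` from the
dyadic tree `𝒯_k` (words over `{0,1}` of length at most `k`, here `List Bool`, with
`α0 = α ++ [false]`, `α1 = α ++ [true]`) to subsets of `S` such that `I(∅) = S`, each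
`I(α)` is nonempty, and for `|α| < k`, `I(α)` is the disjoint union of `I(α0)` and
`I(α1)`. -/
def Adequate (k : ℕ) (S : Finset ℕ) (I : List Bool → Finset ℕ) : Prop :=
  I [] = S ∧
  (∀ α : List Bool, α.length ≤ k → (I α).Nonempty) ∧
  (∀ α : List Bool, α.length < k →
    Disjoint (I (α ++ [false])) (I (α ++ [true])) ∧
    I α = I (α ++ [false]) ∪ I (α ++ [true]))

theorem l2Norm_eq_sqrt_sum {S : Finset ℕ} {f : ℕ → ℝ} (hf : ∀ n ∉ S, f n = 0) :
    l2Norm f = √(∑ n ∈ S, f n ^ 2) := by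
  rw [l2Norm, tsum_eq_sum (s := S)]
  intro n hn
  simp [hf n hn]

theorem l2Norm_eq_norm_toLp {S : Finset ℕ} {f : ℕ → ℝ} (hf : ∀ n ∉ S, f n = 0) :
    l2Norm f = ‖WithLp.toLp 2 (fun n : S => f n)‖ := by
  rw [l2Norm_eq_sqrt_sum hf, EuclideanSpace.norm_eq, ← Finset.sum_coe_sort]
  simp

theorem l2Norm_sub_le {S : Finset ℕ} {f g : ℕ → ℝ} (hf : ∀ n ∉ S, f n = 0)
    (hg : ∀ n ∉ S, g n = 0) :
    l2Norm (fun n => f n - g n) ≤ l2Norm f + l2Norm g := by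
  rw [l2Norm_eq_norm_toLp hf, l2Norm_eq_norm_toLp hg,
    l2Norm_eq_norm_toLp (S := S) (fun n hn => by simp [hf n hn, hg n hn])]
  exact norm_sub_le (WithLp.toLp 2 (fun n : S => f n)) (WithLp.toLp 2 (fun n : S => g n))

theorem l2Norm_sum_le {ι : Type*} (t : Finset ι) {S : Finset ℕ} {f : ι → ℕ → ℝ}
    (hf : ∀ i ∈ t, ∀ n ∉ S, f i n = 0) :
    l2Norm (fun n => ∑ i ∈ t, f i n) ≤ ∑ i ∈ t, l2Norm (f i) := by
  rw [l2Norm_eq_norm_toLp (S := S) (fun n hn => Finset.sum_eq_zero fun i hi => hf i hi n hn),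
    Finset.sum_congr rfl fun i hi => l2Norm_eq_norm_toLp (hf i hi)]
  have htoLp : WithLp.toLp 2 (fun n : S => ∑ i ∈ t, f i n) =
      ∑ i ∈ t, WithLp.toLp 2 (fun n : S => f i n) := by
    ext n
    simp
  rw [htoLp]
  exact norm_sum_le t _

theorem finSupp_indVec (A : Finset ℕ) : FinSupp (indVec A) :=
  A.finite_toSet.subset fun n hn => by
    by_contra h
    exact hn (if_neg h)

theorem indVec_of_notMem {A : Finset ℕ} {n : ℕ} (hn : n ∉ A) : indVec A n = 0 := if_neg hn

theorem l2Norm_indVec (A : Finset ℕ) : l2Norm (indVec A) = √A.card := by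
  rw [l2Norm_eq_sqrt_sum (S := A) fun n hn => indVec_of_notMem hn,
    Finset.sum_congr rfl fun n hn => by rw [indVec, if_pos hn]]
  simp

theorem indVec_union {A B : Finset ℕ} (h : Disjoint A B) :
    indVec (A ∪ B) = indVec A + indVec B := by
  ext n
  have : n ∈ A → n ∉ B := fun hA => Finset.disjoint_left.mp h hA
  by_cases hA : n ∈ A <;> by_cases hB : n ∈ B <;> simp_all [indVec]

theorem sum_ofFn_succ (i : ℕ) (h : List Bool → ℝ) :
    ∑ v : Fin (i + 1) → Bool, h (List.ofFn v) =
      ∑ v : Fin i → Bool, (h (List.ofFn v ++ [false]) + h (List.ofFn v ++ [true])) := by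
  rw [← (Fin.snocEquiv fun _ => Bool).sum_comp, Fintype.sum_prod_type_right]
  refine Finset.sum_congr rfl fun v _ => ?_
  have (b : Bool) : List.ofFn (Fin.snocEquiv (fun _ => Bool) (b, v)) = List.ofFn v ++ [b] := by
    rw [List.ofFn_succ']
    simp [Fin.snocEquiv, List.concat_eq_append]
  simp only [this, Fintype.sum_bool]
  ring

namespace Adequate

variable {k : ℕ} {S : Finset ℕ} {I : List Bool → Finset ℕ}

theorem sum_level (hI : Adequate k S I) (g : ℕ → ℝ) {i : ℕ} (hi : i ≤ k) :
    ∑ v : Fin i → Bool, ∑ n ∈ I (List.ofFn v), g n = ∑ n ∈ S, g n := by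
  induction i with
  | zero => simp [hI.1]
  | succ i ih =>
    rw [sum_ofFn_succ i fun α => ∑ n ∈ I α, g n, ← ih (by omega)]
    refine Finset.sum_congr rfl fun v _ => ?_
    obtain ⟨hd, hu⟩ := hI.2.2 (List.ofFn v) (by simp; omega)
    rw [hu, Finset.sum_union hd]

theorem pow_le_card (hI : Adequate k S I) (j : ℕ) (α : List Bool) (hα : α.length + j = k) :
    2 ^ j ≤ (I α).card := by
  induction j generalizing α with
  | zero => simpa using hI.2.1 α (by omega)
  | succ j ih =>
    obtain ⟨hd, hu⟩ := hI.2.2 α (by omega)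
    rw [hu, Finset.card_union_of_disjoint hd, pow_succ]
    have h₀ := ih (α ++ [false]) (by simp; omega)
    have h₁ := ih (α ++ [true]) (by simp; omega)
    omega

theorem card_ofFn (hI : Adequate k S I) (hS : S.card = 2 ^ k) {i : ℕ} (hi : i ≤ k)
    (v : Fin i → Bool) : (I (List.ofFn v)).card = 2 ^ (k - i) := by
  have hle (w : Fin i → Bool) : 2 ^ (k - i) ≤ (I (List.ofFn w)).card :=
    hI.pow_le_card _ _ (by simp; omega)
  have hsum : ∑ w : Fin i → Bool, (I (List.ofFn w)).card = 2 ^ k := by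
    have := hI.sum_level (fun _ => 1) hi
    simp only [Finset.sum_const, nsmul_eq_mul, mul_one, hS] at this
    exact_mod_cast this
  have heq : ∑ _w : Fin i → Bool, 2 ^ (k - i) = ∑ w : Fin i → Bool, (I (List.ofFn w)).card := by
    simp [hsum, ← pow_add, hi]
  exact ((Finset.sum_eq_sum_iff_of_le fun w _ => hle w).mp heq v (Finset.mem_univ v)).symm

theorem card_eq (hI : Adequate k S I) (hS : S.card = 2 ^ k) {α : List Bool}
    (hα : α.length ≤ k) : (I α).card = 2 ^ (k - α.length) := by
  simpa using hI.card_ofFn hS hα α.get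

theorem sum_indicator (hI : Adequate k S I) {i : ℕ} (hi : i ≤ k) (n : ℕ) :
    ∑ v : Fin i → Bool, (if n ∈ I (List.ofFn v) then (1 : ℝ) else 0) =
      if n ∈ S then 1 else 0 := by
  simpa using hI.sum_level (fun m => if n = m then 1 else 0) hi

theorem notMem_of_ne (hI : Adequate k S I) {i : ℕ} (hi : i ≤ k) {v w : Fin i → Bool}
    (hvw : w ≠ v) {n : ℕ} (hn : n ∈ I (List.ofFn v)) : n ∉ I (List.ofFn w) := by
  intro hw
  have h := hI.sum_indicator hi n
  have h₂ : ∑ u ∈ {v, w}, (if n ∈ I (List.ofFn u) then (1 : ℝ) else 0) ≤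
      ∑ u : Fin i → Bool, (if n ∈ I (List.ofFn u) then (1 : ℝ) else 0) :=
    Finset.sum_le_univ_sum_of_nonneg fun u => by split_ifs <;> norm_num
  rw [h, Finset.sum_pair hvw.symm, if_pos hn, if_pos hw] at h₂
  split_ifs at h₂ <;> norm_num at h₂

theorem subset (hI : Adequate k S I) {i : ℕ} (hi : i ≤ k) (v : Fin i → Bool) :
    I (List.ofFn v) ⊆ S := by
  intro n hn
  by_contra hnS
  have h := hI.sum_indicator hi n
  have h₂ := Finset.single_le_sum (f := fun u : Fin i → Bool =>
    if n ∈ I (List.ofFn u) then (1 : ℝ) else 0)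
    (fun u _ => by split_ifs <;> norm_num) (Finset.mem_univ v)
  rw [h, if_neg hnS, if_pos hn] at h₂
  norm_num at h₂

/-- Functions supported on the cells of one level of an adequate partition are orthogonal. -/
theorem l2Norm_sum_level_le (hI : Adequate k S I) {i : ℕ} (hi : i ≤ k)
    {r : List Bool → ℕ → ℝ} {c : ℝ}
    (hr : ∀ v : Fin i → Bool, ∀ n ∉ I (List.ofFn v), r (List.ofFn v) n = 0)
    (hc : ∀ v : Fin i → Bool, l2Norm (r (List.ofFn v)) ≤ √c) (hc₀ : 0 ≤ c) :
    l2Norm (fun n => ∑ v : Fin i → Bool, r (List.ofFn v) n) ≤ √(2 ^ i * c) := by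
  rw [l2Norm_eq_sqrt_sum (S := S) fun n hn => Finset.sum_eq_zero fun v _ =>
    hr v n fun h => hn (hI.subset hi v h)]
  refine Real.sqrt_le_sqrt ?_
  rw [← hI.sum_level _ hi]
  calc _ ≤ ∑ v : Fin i → Bool, c := Finset.sum_le_sum fun v _ => ?_
    _ = 2 ^ i * c := by simp
  have hcv := hc v
  rw [l2Norm_eq_sqrt_sum (hr v), Real.sqrt_le_sqrt_iff hc₀] at hcv
  refine le_trans (le_of_eq (Finset.sum_congr rfl fun n hn => ?_)) hcv
  rw [Finset.sum_eq_single v (fun w _ hw => hr w n (hI.notMem_of_ne hi hw hn)) (by simp)]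

theorem sum_leaves (hI : Adequate k S I) (hS : S.card = 2 ^ k) (F : (ℕ → ℝ) → ℕ → ℝ) (n : ℕ) :
    ∑ v : Fin k → Bool, F (indVec (I (List.ofFn v))) n = ∑ s ∈ S, F (indVec {s}) n := by
  rw [← hI.sum_level _ le_rfl]
  refine Finset.sum_congr rfl fun v _ => ?_
  obtain ⟨s, hs⟩ := Finset.card_eq_one.mp ((hI.card_ofFn hS le_rfl v).trans (by simp))
  simp [hs]

end Adequate

/-- The defect `H(x_α) - H(x_α0) - H(x_α1) - Φ(x_α)` at a node `α` of the tree. -/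
noncomputable def treeDefect (Φ H : (ℕ → ℝ) → (ℕ → ℝ)) (I : List Bool → Finset ℕ)
    (α : List Bool) (n : ℕ) : ℝ :=
  H (indVec (I α)) n - H (indVec (I (α ++ [false]))) n - H (indVec (I (α ++ [true]))) n -
    Φ (indVec (I α)) n

namespace Adequate

variable {k : ℕ} {S : Finset ℕ} {I : List Bool → Finset ℕ} {Φ H : (ℕ → ℝ) → (ℕ → ℝ)} {K : ℝ}

theorem treeDefect_eq_zero (hI : Adequate k S I)
    (hΦ_supp : ∀ x : ℕ → ℝ, FinSupp x → ∀ n, x n = 0 → Φ x n = 0)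
    (hH_supp : ∀ x : ℕ → ℝ, FinSupp x → ∀ n, x n = 0 → H x n = 0)
    {α : List Bool} (hα : α.length < k) {n : ℕ} (hn : n ∉ I α) :
    treeDefect Φ H I α n = 0 := by
  have hu := (hI.2.2 α hα).2
  have hn' := hn
  rw [hu, Finset.mem_union, not_or] at hn'
  have hH {A : Finset ℕ} (h : n ∉ A) : H (indVec A) n = 0 :=
    hH_supp _ (finSupp_indVec A) n (indVec_of_notMem h)
  rw [treeDefect, hH hn, hH hn'.1, hH hn'.2,
    hΦ_supp _ (finSupp_indVec _) n (indVec_of_notMem hn)]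
  norm_num

theorem l2Norm_treeDefect_le (hI : Adequate k S I) (hS : S.card = 2 ^ k)
    (hK : ∀ x y : ℕ → ℝ, FinSupp x → FinSupp y →
      (∀ n, x n = 0 ∨ y n = 0) → l2Norm x = l2Norm y →
      l2Norm (fun n => H (x + y) n - H x n - H y n - Φ (x + y) n) ≤ K * l2Norm x)
    {α : List Bool} (hα : α.length < k) :
    l2Norm (treeDefect Φ H I α) ≤ K * √(2 ^ (k - 1 - α.length)) := by
  obtain ⟨hd, hu⟩ := hI.2.2 α hα
  have hcard (b : Bool) : (I (α ++ [b])).card = 2 ^ (k - 1 - α.length) := by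
    rw [hI.card_eq hS (by simp; omega)]
    congr 1
    simp only [List.length_append, List.length_cons, List.length_nil]
    omega
  have h := hK (indVec (I (α ++ [false]))) (indVec (I (α ++ [true])))
    (finSupp_indVec _) (finSupp_indVec _)
    (fun n => by
      by_cases hn : n ∈ I (α ++ [false])
      · exact .inr (indVec_of_notMem (Finset.disjoint_left.mp hd hn))
      · exact .inl (indVec_of_notMem hn))
    (by rw [l2Norm_indVec, l2Norm_indVec, hcard, hcard])
  rw [← indVec_union hd, ← hu, l2Norm_indVec, hcard] at h
  exact_mod_cast h

theorem l2Norm_sum_treeDefect_le (hI : Adequate k S I) (hS : S.card = 2 ^ k)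
    (hΦ_supp : ∀ x : ℕ → ℝ, FinSupp x → ∀ n, x n = 0 → Φ x n = 0)
    (hH_supp : ∀ x : ℕ → ℝ, FinSupp x → ∀ n, x n = 0 → H x n = 0)
    (hK : ∀ x y : ℕ → ℝ, FinSupp x → FinSupp y →
      (∀ n, x n = 0 ∨ y n = 0) → l2Norm x = l2Norm y →
      l2Norm (fun n => H (x + y) n - H x n - H y n - Φ (x + y) n) ≤ K * l2Norm x) :
    l2Norm (fun n => ∑ i ∈ Finset.range k, ∑ v : Fin i → Bool,
      treeDefect Φ H I (List.ofFn v) n) ≤ k * (K * √(2 ^ (k - 1))) := by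
  refine (l2Norm_sum_le (S := S) _ fun i hi n hn => Finset.sum_eq_zero fun v _ => ?_).trans ?_
  · have hi := Finset.mem_range.mp hi
    exact hI.treeDefect_eq_zero hΦ_supp hH_supp (by simpa using hi)
      fun h => hn (hI.subset hi.le v h)
  calc _ ≤ ∑ i ∈ Finset.range k, K * √(2 ^ (k - 1)) := Finset.sum_le_sum fun i hi => ?_
    _ = _ := by simp
  have hi := Finset.mem_range.mp hi
  have hbound (v : Fin i → Bool) := hI.l2Norm_treeDefect_le hS hK
    (α := List.ofFn v) (by simpa using hi)
  simp only [List.length_ofFn] at hbound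
  have hK₀ : 0 ≤ K := nonneg_of_mul_nonneg_left
    ((Real.sqrt_nonneg _).trans (hbound fun _ => false)) (by positivity)
  have hsqrt (m : ℕ) : K * √(2 ^ m) = √(K ^ 2 * 2 ^ m) := by
    rw [Real.sqrt_mul (sq_nonneg K), Real.sqrt_sq hK₀]
  simp only [hsqrt] at hbound ⊢
  refine (hI.l2Norm_sum_level_le hi.le (fun v n hn => hI.treeDefect_eq_zero hΦ_supp hH_supp
    (by simpa using hi) hn) hbound (by positivity)).trans_eq ?_
  congr 1
  rw [mul_left_comm, ← pow_add]
  congr 2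
  omega

theorem sum_eq_sub_sum_treeDefect (hI : Adequate k S I) (hS : S.card = 2 ^ k) (n : ℕ) :
    ∑ i ∈ Finset.range (k + 1), ∑ v : Fin i → Bool, Φ (indVec (I (List.ofFn v))) n =
      H (indVec S) n - ∑ s ∈ S, H (indVec {s}) n + ∑ s ∈ S, Φ (indVec {s}) n -
        ∑ i ∈ Finset.range k, ∑ v : Fin i → Bool, treeDefect Φ H I (List.ofFn v) n := by
  have htel := Finset.sum_range_sub'
    (fun i => ∑ v : Fin i → Bool, H (indVec (I (List.ofFn v))) n) k
  have hlevel (i : ℕ) : ∑ v : Fin i → Bool, treeDefect Φ H I (List.ofFn v) n =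
      (∑ v : Fin i → Bool, H (indVec (I (List.ofFn v))) n -
        ∑ v : Fin (i + 1) → Bool, H (indVec (I (List.ofFn v))) n) -
      ∑ v : Fin i → Bool, Φ (indVec (I (List.ofFn v))) n := by
    rw [sum_ofFn_succ i fun α => H (indVec (I α)) n, ← Finset.sum_sub_distrib,
      ← Finset.sum_sub_distrib]
    refine Finset.sum_congr rfl fun v _ => ?_
    rw [treeDefect]
    ring
  have hroot : ∑ v : Fin 0 → Bool, H (indVec (I (List.ofFn v))) n = H (indVec S) n := by
    simp [hI.1]
  rw [Finset.sum_congr rfl fun i _ => hlevel i, Finset.sum_sub_distrib, htel, hroot,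
    Finset.sum_range_succ, hI.sum_leaves hS H, hI.sum_leaves hS Φ]
  ring

end Adequate

/-- Let `|S| = 2^k`, let `I, J` be adequate partitions of `S` with
associated vectors `x_α = 1_{I(α)}`, `y_α = 1_{J(α)}`. Let `Φ, H : c00 → ℓ₂` be
homogeneous support-preserving maps and `K` a constant such that
`‖H(x+y) − H(x) − H(y) − Φ(x+y)‖₂ ≤ K‖x‖₂` whenever `x, y ∈ c00` are disjointly
supported with `‖x‖₂ = ‖y‖₂`. Then
`‖Σ_{α∈𝒯_k}(Φ(x_α) − Φ(y_α))‖₂ ≤ 2Kk√(2^{k−1})`. -/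
theorem tree_estimate_full
    (k : ℕ) (hk : 1 ≤ k) (S : Finset ℕ) (hS : S.card = 2 ^ k)
    (I J : List Bool → Finset ℕ) (hI : Adequate k S I) (hJ : Adequate k S J)
    (Φ H : (ℕ → ℝ) → (ℕ → ℝ))
    (hΦ_l2 : ∀ x, FinSupp x → Summable (fun n => (Φ x n) ^ 2))
    (hH_l2 : ∀ x, FinSupp x → Summable (fun n => (H x n) ^ 2))
    (hΦ_homog : ∀ (c : ℝ) (x : ℕ → ℝ), FinSupp x → Φ (c • x) = c • Φ x)
    (hH_homog : ∀ (c : ℝ) (x : ℕ → ℝ), FinSupp x → H (c • x) = c • H x)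
    (hΦ_supp : ∀ x : ℕ → ℝ, FinSupp x → ∀ n, x n = 0 → Φ x n = 0)
    (hH_supp : ∀ x : ℕ → ℝ, FinSupp x → ∀ n, x n = 0 → H x n = 0)
    (K : ℝ)
    (hK : ∀ x y : ℕ → ℝ, FinSupp x → FinSupp y →
      (∀ n, x n = 0 ∨ y n = 0) → l2Norm x = l2Norm y →
      l2Norm (fun n => H (x + y) n - H x n - H y n - Φ (x + y) n) ≤ K * l2Norm x) :
    l2Norm (fun n =>
        ∑ i ∈ Finset.range (k + 1), ∑ v : Fin i → Bool,
          (Φ (indVec (I (List.ofFn v))) n - Φ (indVec (J (List.ofFn v))) n))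
      ≤ 2 * K * (k : ℝ) * Real.sqrt ((2 : ℝ) ^ (k - 1)) := by
  have hsum (I' : List Bool → Finset ℕ) (hI' : Adequate k S I') (n : ℕ) (hn : n ∉ S) :
      ∑ i ∈ Finset.range k, ∑ v : Fin i → Bool, treeDefect Φ H I' (List.ofFn v) n = 0 :=
    Finset.sum_eq_zero fun i hi => Finset.sum_eq_zero fun v _ =>
      hI'.treeDefect_eq_zero hΦ_supp hH_supp (by simpa using hi)
        fun h => hn (hI'.subset (Finset.mem_range.mp hi).le v h)
  have heq : (fun n => ∑ i ∈ Finset.range (k + 1), ∑ v : Fin i → Bool,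
        (Φ (indVec (I (List.ofFn v))) n - Φ (indVec (J (List.ofFn v))) n)) =
      fun n => ∑ i ∈ Finset.range k, ∑ v : Fin i → Bool, treeDefect Φ H J (List.ofFn v) n -
        ∑ i ∈ Finset.range k, ∑ v : Fin i → Bool, treeDefect Φ H I (List.ofFn v) n := by
    ext n
    simp only [Finset.sum_sub_distrib]
    rw [hI.sum_eq_sub_sum_treeDefect (H := H) hS, hJ.sum_eq_sub_sum_treeDefect (H := H) hS]
    ring
  rw [heq]
  refine (l2Norm_sub_le (hsum J hJ) (hsum I hI)).trans ?_
  have hIle := hI.l2Norm_sum_treeDefect_le hS hΦ_supp hH_supp hK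
  have hJle := hJ.l2Norm_sum_treeDefect_le hS hΦ_supp hH_supp hK
  linarith
end
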